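/- Let f : ℝ → ℝ be infinitely differentiable, let x ∈ ℝ with f′(x) ≠ 0, and let p > 0 be a real exponent. Then the WENO-ZC weights are well defined for all sufficiently small Δx > 0 and satisfy, for each k ∈ {0,1,2} and each choice of sign, ω_k^{ZC,±}(x,Δx) = d_k + O(Δx^{6p}) as Δx → 0⁺. -/

import Mathlib

/-- The Jiang--Shu smoothness indicators `β₀, β₁, β₂`; the right-boundary
indicators are `wenoBeta f x Δx k` and the left-boundary ones are
`wenoBeta f (x - Δx) Δx k`. -/
noncomputable def wenoBeta (f : ℝ → ℝ) (x Δx : ℝ) : Fin 3 → ℝ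
  | 0 => (1 / 4) * (f (x - 2 * Δx) - 4 * f (x - Δx) + 3 * f x) ^ 2
       + (13 / 12) * (f (x - 2 * Δx) - 2 * f (x - Δx) + f x) ^ 2
  | 1 => (1 / 4) * (f (x + Δx) - f (x - Δx)) ^ 2
       + (13 / 12) * (f (x - Δx) - 2 * f x + f (x + Δx)) ^ 2
  | 2 => (1 / 4) * (3 * f x - 4 * f (x + Δx) + f (x + 2 * Δx)) ^ 2
       + (13 / 12) * (f x - 2 * f (x + Δx) + f (x + 2 * Δx)) ^ 2

/-- The global smoothness indicator `τ(x,Δx) = |β₂(x,Δx) − β₀(x,Δx)|`. -/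
noncomputable def wenoTau (f : ℝ → ℝ) (x Δx : ℝ) : ℝ :=
  |wenoBeta f x Δx 2 - wenoBeta f x Δx 0|

/-- The mean smoothness indicator `β̄(x,Δx) = (β₀ + β₁ + β₂)/3`. -/
noncomputable def wenoBetaBar (f : ℝ → ℝ) (x Δx : ℝ) : ℝ :=
  (wenoBeta f x Δx 0 + wenoBeta f x Δx 1 + wenoBeta f x Δx 2) / 3

/-- The ideal weights `(d₀, d₁, d₂) = (1/10, 6/10, 3/10)`. -/
noncomputable def wenoD : Fin 3 → ℝ
  | 0 => 1 / 10
  | 1 => 6 / 10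
  | 2 => 3 / 10

/-- The centering coefficients `(c₀, c₁, c₂) = (3/4, 3/2, 3/4)`. -/
noncomputable def wenoCk : Fin 3 → ℝ
  | 0 => 3 / 4
  | 1 => 3 / 2
  | 2 => 3 / 4

/-- The unnormalized WENO-ZC weights (with `ε = 0` and real exponent `p`):
`α_k^{ZC} = d_k·[1 + c_k·(τ/β_k)^p·(τ/(τ + β̄))^p]`. -/
noncomputable def alphaZC (p : ℝ) (f : ℝ → ℝ) (x Δx : ℝ) (k : Fin 3) : ℝ :=
  wenoD k * (1 + wenoCk k * (wenoTau f x Δx / wenoBeta f x Δx k) ^ p *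
    (wenoTau f x Δx / (wenoTau f x Δx + wenoBetaBar f x Δx)) ^ p)

/-- The normalized WENO-ZC weights. -/
noncomputable def omegaZC (p : ℝ) (f : ℝ → ℝ) (x Δx : ℝ) (k : Fin 3) : ℝ :=
  alphaZC p f x Δx k / (∑ j : Fin 3, alphaZC p f x Δx j)

theorem weno_step (F F' : ℝ → ℝ) (M : ℝ) (n : ℕ) (hM : 0 ≤ M)
    (hd : ∀ t, HasDerivAt F (F' t) t) (h0 : F 0 = 0)
    (hb : ∀ t, |t| ≤ 1 → |F' t| ≤ M * |t| ^ n) :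
    ∀ t, |t| ≤ 1 → |F t| ≤ M * |t| ^ (n + 1) := by
  intro t ht
  have hconv : Convex ℝ (Set.Icc (-|t|) (|t|)) := convex_Icc _ _
  have := hconv.norm_image_sub_le_of_norm_hasDerivWithin_le (f := F) (f' := F')
    (C := M * |t| ^ n) (x := 0) (y := t)
    (fun s _ => (hd s).hasDerivWithinAt)
    (fun s hs => by
      have hs' : |s| ≤ |t| := abs_le.mpr hs
      rw [Real.norm_eq_abs]
      refine (hb s (hs'.trans ht)).trans ?_
      gcongr)
    ⟨by simp, by simp⟩ ⟨neg_abs_le t, le_abs_self t⟩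
  rw [h0, sub_zero, sub_zero, Real.norm_eq_abs, Real.norm_eq_abs] at this
  rw [pow_succ, ← mul_assoc]
  exact this

theorem weno_bdd (g : ℝ → ℝ) (hg : Continuous g) (x : ℝ) :
    ∃ M : ℝ, 0 ≤ M ∧ ∀ z, |z - x| ≤ 2 → |g z| ≤ M := by
  obtain ⟨M, hM⟩ := (isCompact_Icc (a := x - 2) (b := x + 2)).exists_bound_of_continuousOn
    hg.continuousOn
  refine ⟨M, (abs_nonneg _).trans (hM x ⟨by linarith, by linarith⟩), fun z hz => ?_⟩
  have := abs_le.mp hz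
  exact hM z ⟨by linarith, by linarith⟩

theorem weno_taylor (f : ℝ → ℝ) (hf : ContDiff ℝ (⊤ : ℕ∞) f) (x : ℝ) :
    ∃ M : ℝ, 0 < M ∧ ∀ y, |y - x| ≤ 1 → ∃ a2 a3 : ℝ,
      |deriv f y| ≤ M ∧ |a2| ≤ M ∧ |a3| ≤ M ∧
      ∀ t, |t| ≤ 1 → |f (y + t) - f y - deriv f y * t - a2 * t ^ 2 - a3 * t ^ 3| ≤ M * t ^ 4 := by
  have key : ∀ g : ℝ → ℝ, ContDiff ℝ (⊤ : ℕ∞) g →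
      ContDiff ℝ (⊤ : ℕ∞) (deriv g) ∧ ∀ z, HasDerivAt g (deriv g z) z := by
    intro g hg
    have := contDiff_infty_iff_deriv.mp hg
    exact ⟨this.2, fun z => (this.1 z).hasDerivAt⟩
  obtain ⟨h1, d0⟩ := key f hf
  obtain ⟨h2, d1⟩ := key _ h1
  obtain ⟨h3, d2⟩ := key _ h2
  obtain ⟨h4, d3⟩ := key _ h3
  set f1 := deriv f
  set f2 := deriv f1
  set f3 := deriv f2
  set f4 := deriv f3
  obtain ⟨M1, p1, b1⟩ := weno_bdd f1 h1.continuous x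
  obtain ⟨M2, p2, b2⟩ := weno_bdd f2 h2.continuous x
  obtain ⟨M3, p3, b3⟩ := weno_bdd f3 h3.continuous x
  obtain ⟨M4, p4, b4⟩ := weno_bdd f4 h4.continuous x
  refine ⟨M1 + M2 + M3 + M4 + 1, by positivity, fun y hy => ⟨f2 y / 2, f3 y / 6, ?_, ?_, ?_, ?_⟩⟩
  · linarith [b1 y (by linarith)]
  · rw [abs_div, abs_two]; linarith [b2 y (by linarith)]
  · rw [abs_div, abs_of_pos (by norm_num : (0:ℝ) < 6)]; linarith [b3 y (by linarith)]
  intro t ht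
  have sh : ∀ g g' : ℝ → ℝ, (∀ z, HasDerivAt g (g' z) z) → ∀ s,
      HasDerivAt (fun s => g (y + s)) (g' (y + s)) s := by
    intro g g' hg s
    exact (hg (y + s)).comp_const_add y s
  have e1 := weno_step (fun t => f3 (y + t) - f3 y) (fun t => f4 (y + t)) M4 0 p4
    (fun s => (sh _ _ d3 s).sub_const _) (by simp)
    (fun s hs => by
      simp only [pow_zero, mul_one]
      apply b4
      have := abs_add_le (y - x) s
      rw [show y + s - x = y - x + s by ring]
      linarith)
  have e2 := weno_step (fun t => f2 (y + t) - f2 y - f3 y * t)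
    (fun t => f3 (y + t) - f3 y) M4 1 p4
    (fun s => by
      have := ((sh _ _ d2 s).sub_const (f2 y)).sub ((hasDerivAt_id s).const_mul (f3 y))
      exact this.congr_deriv (by ring)) (by simp) e1
  have e3 := weno_step (fun t => f1 (y + t) - f1 y - f2 y * t - f3 y / 2 * t ^ 2)
    (fun t => f2 (y + t) - f2 y - f3 y * t) M4 2 p4
    (fun s => by
      have := (((sh _ _ d1 s).sub_const (f1 y)).sub ((hasDerivAt_id s).const_mul (f2 y))).sub
        ((hasDerivAt_pow 2 s).const_mul (f3 y / 2))
      exact this.congr_deriv (by push_cast; ring)) (by simp) e2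
  have e4 := weno_step (fun t => f (y + t) - f y - f1 y * t - f2 y / 2 * t ^ 2 - f3 y / 6 * t ^ 3)
    (fun t => f1 (y + t) - f1 y - f2 y * t - f3 y / 2 * t ^ 2) M4 3 p4
    (fun s => by
      have := ((((sh _ _ d0 s).sub_const (f y)).sub ((hasDerivAt_id s).const_mul (f1 y))).sub
        ((hasDerivAt_pow 2 s).const_mul (f2 y / 2))).sub
        ((hasDerivAt_pow 3 s).const_mul (f3 y / 6))
      exact this.congr_deriv (by push_cast; ring)) (by simp) e3 t ht
  have h4 : |t| ^ (3 + 1) = t ^ 4 := by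
    show |t| ^ 4 = t ^ 4
    exact Even.pow_abs (by decide) t
  rw [h4] at e4
  refine e4.trans ?_
  have : 0 ≤ t ^ 4 := by positivity
  nlinarith [mul_nonneg p1 this, mul_nonneg p2 this, mul_nonneg p3 this]

set_option maxHeartbeats 4000000 in
/-- The basic two-sided estimates. -/
theorem weno_est (f : ℝ → ℝ) (hf : ContDiff ℝ (⊤ : ℕ∞) f) (x : ℝ) (hx : deriv f x ≠ 0) :
    ∃ δ > (0 : ℝ), ∃ c > (0 : ℝ), ∃ C > (0 : ℝ), ∀ y h : ℝ, |y - x| < δ → 0 < h → h < δ →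
      (∀ k, c * h ^ 2 ≤ wenoBeta f y h k) ∧ wenoTau f y h ≤ C * h ^ 5 := by
  obtain ⟨M, hM, H⟩ := weno_taylor f hf x
  have hcont : Continuous (deriv f) := (contDiff_infty_iff_deriv.mp hf).2.continuous
  set m := |deriv f x| / 2 with hm
  have hmpos : 0 < m := by have := abs_pos.mpr hx; positivity
  have hev : ∀ᶠ y in nhds x, m < |deriv f y| :=
    (hcont.abs.tendsto x).eventually (lt_mem_nhds (by linarith))
  obtain ⟨δ₀, hδ₀, hball⟩ := Metric.eventually_nhds_iff.mp hev
  refine ⟨min δ₀ (min (1 / 2) (m / (100 * M))), by positivity, m ^ 2 / 4, by positivity,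
    10000 * M ^ 2, by positivity, ?_⟩
  intro y h hy h0 hh
  simp only [lt_min_iff] at hy hh
  obtain ⟨hy1, hy2, -⟩ := hy
  obtain ⟨-, hh2, hh3⟩ := hh
  have hmy : m < |deriv f y| := hball (by rwa [Real.dist_eq])
  obtain ⟨a2, a3, hb1, hb2, hb3, R⟩ := H y (by linarith)
  rw [lt_div_iff₀ (by positivity)] at hh3
  set a1 := deriv f y
  have r1 := R h (by rw [abs_of_pos h0]; linarith)
  have r2 := R (2 * h) (by rw [abs_of_pos (by linarith)]; linarith)
  have s1 := R (-h) (by rw [abs_neg, abs_of_pos h0]; linarith)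
  have s2 := R (-(2 * h)) (by rw [abs_neg, abs_of_pos (by linarith)]; linarith)
  rw [← sub_eq_add_neg] at s1 s2
  generalize hP1 : f (y + h) = P1 at *
  generalize hP2 : f (y + 2 * h) = P2 at *
  generalize hN1 : f (y - h) = N1 at *
  generalize hN2 : f (y - 2 * h) = N2 at *
  generalize hO : f y = O at *
  -- work with remainders
  obtain ⟨ρ1, hρ1⟩ : ∃ r, r = P1 - O - a1 * h - a2 * h ^ 2 - a3 * h ^ 3 := ⟨_, rfl⟩
  obtain ⟨ρ2, hρ2⟩ : ∃ r, r = P2 - O - a1 * (2 * h) - a2 * (2 * h) ^ 2 - a3 * (2 * h) ^ 3 :=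
    ⟨_, rfl⟩
  obtain ⟨σ1, hσ1⟩ : ∃ r, r = N1 - O - a1 * (-h) - a2 * (-h) ^ 2 - a3 * (-h) ^ 3 := ⟨_, rfl⟩
  obtain ⟨σ2, hσ2⟩ : ∃ r, r = N2 - O - a1 * (-(2 * h)) - a2 * (-(2 * h)) ^ 2
    - a3 * (-(2 * h)) ^ 3 := ⟨_, rfl⟩
  rw [← hρ1] at r1
  rw [← hρ2, show M * (2 * h) ^ 4 = 16 * (M * h ^ 4) by ring] at r2
  rw [← hσ1, show M * (-h) ^ 4 = M * h ^ 4 by ring] at s1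
  rw [← hσ2, show M * (-(2 * h)) ^ 4 = 16 * (M * h ^ 4) by ring] at s2
  have q3 : |a3 * h ^ 3| ≤ M * h ^ 3 := by
    rw [abs_mul, abs_of_pos (pow_pos h0 3)]; gcongr
  have q2 : |a2 * h ^ 2| ≤ M * h ^ 2 := by
    rw [abs_mul, abs_of_pos (pow_pos h0 2)]; gcongr
  have q1 : |a1 * h| ≤ M * h := by
    rw [abs_mul, abs_of_pos h0]; gcongr
  have l4 : M * h ^ 4 ≤ M * h ^ 3 / 2 := by
    have : 0 < M * h ^ 3 := by positivity
    nlinarith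
  have l3 : M * h ^ 3 ≤ M * h ^ 2 / 2 := by
    have : 0 < M * h ^ 2 := by positivity
    nlinarith
  have l2 : M * h ^ 2 ≤ M * h / 2 := by
    have : 0 < M * h := by positivity
    nlinarith
  have l2' : 100 * (M * h ^ 2) ≤ m * h := by
    have := mul_le_mul_of_nonneg_right hh3.le h0.le
    linarith
  have hmh : m * h ≤ |a1 * h| := by
    rw [abs_mul, abs_of_pos h0]; gcongr
  have sqb : ∀ A B : ℝ, m * h ≤ |A| → m ^ 2 / 4 * h ^ 2 ≤ 1 / 4 * A ^ 2 + 13 / 12 * B ^ 2 := by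
    intro A B hA
    have : (m * h) ^ 2 ≤ A ^ 2 := by
      rw [← sq_abs A]; gcongr
    nlinarith [sq_nonneg B]
  have low : ∀ A e : ℝ, A = 2 * (a1 * h) + e → |e| ≤ 100 * (M * h ^ 2) → m * h ≤ |A| := by
    intro A e hA he
    have := abs_sub_abs_le_abs_sub (2 * (a1 * h)) (-e)
    rw [abs_mul, abs_two, abs_neg, sub_neg_eq_add, ← hA] at this
    linarith
  rw [abs_le] at r1 r2 s1 s2 q1 q2 q3
  constructor
  · intro k
    fin_cases k
    · simp only [wenoBeta, Fin.zero_eta, hP1, hP2, hN1, hN2, hO]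
      refine sqb _ _ (low _ (4 * -(a3 * h ^ 3) + σ2 - 4 * σ1) (by rw [hσ1, hσ2]; ring) ?_)
      rw [abs_le]; constructor <;> linarith
    · simp only [wenoBeta, Fin.mk_one, hP1, hP2, hN1, hN2, hO]
      refine sqb _ _ (low _ (2 * (a3 * h ^ 3) + ρ1 - σ1) (by rw [hρ1, hσ1]; ring) ?_)
      rw [abs_le]; constructor <;> linarith
    · simp only [wenoBeta, Fin.reduceFinMk, hP1, hP2, hN1, hN2, hO]
      refine sqb _ _ ?_
      rw [← abs_neg]
      refine (low _ (-(4 * (a3 * h ^ 3) + ρ2 - 4 * ρ1)) (by rw [hρ1, hρ2]; ring) ?_)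
      rw [abs_le]; constructor <;> linarith
  · simp only [wenoTau, wenoBeta, hP1, hP2, hN1, hN2, hO]
    have u1 : |(3 * O - 4 * P1 + P2) + (N2 - 4 * N1 + 3 * O)| ≤ 40 * (M * h ^ 4) := by
      rw [show (3 * O - 4 * P1 + P2) + (N2 - 4 * N1 + 3 * O) = ρ2 + σ2 - 4 * ρ1 - 4 * σ1 by
        rw [hρ1, hρ2, hσ1, hσ2]; ring, abs_le]
      constructor <;> linarith
    have u2 : |(3 * O - 4 * P1 + P2) - (N2 - 4 * N1 + 3 * O)| ≤ 40 * (M * h) := by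
      rw [show (3 * O - 4 * P1 + P2) - (N2 - 4 * N1 + 3 * O) =
        -4 * (a1 * h) + 8 * (a3 * h ^ 3) + ρ2 - σ2 - 4 * ρ1 + 4 * σ1 by
        rw [hρ1, hρ2, hσ1, hσ2]; ring, abs_le]
      constructor <;> linarith
    have u3 : |(O - 2 * P1 + P2) - (N2 - 2 * N1 + O)| ≤ 40 * (M * h ^ 3) := by
      rw [show (O - 2 * P1 + P2) - (N2 - 2 * N1 + O) =
        12 * (a3 * h ^ 3) + ρ2 - σ2 - 2 * ρ1 + 2 * σ1 by
        rw [hρ1, hρ2, hσ1, hσ2]; ring, abs_le]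
      constructor <;> linarith
    have u4 : |(O - 2 * P1 + P2) + (N2 - 2 * N1 + O)| ≤ 40 * (M * h ^ 2) := by
      rw [show (O - 2 * P1 + P2) + (N2 - 2 * N1 + O) =
        4 * (a2 * h ^ 2) + ρ2 + σ2 - 2 * ρ1 - 2 * σ1 by
        rw [hρ1, hρ2, hσ1, hσ2]; ring, abs_le]
      constructor <;> linarith
    have v1 := mul_le_mul u1 u2 (abs_nonneg _) (by positivity)
    have v2 := mul_le_mul u3 u4 (abs_nonneg _) (by positivity)
    rw [← abs_mul] at v1 v2
    have w : 0 ≤ M ^ 2 * h ^ 5 := by positivity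
    have v1' := abs_le.mp v1
    have v2' := abs_le.mp v2
    have hid : ∀ A B A' B' : ℝ, 1 / 4 * A ^ 2 + 13 / 12 * B ^ 2 -
        (1 / 4 * A' ^ 2 + 13 / 12 * B' ^ 2) =
        1 / 4 * ((A + A') * (A - A')) + 13 / 12 * ((B - B') * (B + B')) := by
      intros; ring
    rw [hid, abs_le]
    rw [show 40 * (M * h ^ 4) * (40 * (M * h)) = 1600 * (M ^ 2 * h ^ 5) by ring] at v1'
    rw [show 40 * (M * h ^ 3) * (40 * (M * h ^ 2)) = 1600 * (M ^ 2 * h ^ 5) by ring] at v2'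
    rw [mul_assoc]
    constructor <;> linarith

theorem weno_final (p : ℝ) (hp : 0 < p) (f : ℝ → ℝ) (y h c C : ℝ) (hc : 0 < c) (hC : 0 < C)
    (h0 : 0 < h) (hβ : ∀ k, c * h ^ 2 ≤ wenoBeta f y h k) (hτ : wenoTau f y h ≤ C * h ^ 5) :
    (∀ k, wenoBeta f y h k ≠ 0) ∧ wenoTau f y h + wenoBetaBar f y h ≠ 0 ∧
    (∑ j : Fin 3, alphaZC p f y h j) ≠ 0 ∧
    ∀ k, |omegaZC p f y h k - wenoD k| ≤ (3 / 2 * ((C / c) ^ p * (C / c) ^ p)) * h ^ (6 * p) := by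
  have hch : 0 < c * h ^ 2 := by positivity
  have hτ0 : 0 ≤ wenoTau f y h := abs_nonneg _
  have hbar : c * h ^ 2 ≤ wenoBetaBar f y h := by
    unfold wenoBetaBar; linarith [hβ 0, hβ 1, hβ 2]
  have rat : ∀ b, c * h ^ 2 ≤ b → 0 ≤ (wenoTau f y h / b) ^ p ∧
      (wenoTau f y h / b) ^ p ≤ (C / c) ^ p * h ^ (3 * p) := by
    intro b hb
    have hb0 : 0 < b := by linarith
    refine ⟨by positivity, ?_⟩
    have e : C / c * h ^ 3 = C * h ^ 5 / (c * h ^ 2) := by field_simp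
    have : wenoTau f y h / b ≤ C / c * h ^ 3 := by
      rw [e]; gcongr
    calc _ ≤ (C / c * h ^ 3) ^ p := by gcongr
      _ = _ := by
        rw [Real.mul_rpow (by positivity) (by positivity), ← Real.rpow_natCast h 3,
          ← Real.rpow_mul h0.le]; norm_num
  set K := (C / c) ^ p * (C / c) ^ p with hK
  have hE : ∀ k, 0 ≤ wenoCk k * (wenoTau f y h / wenoBeta f y h k) ^ p *
    (wenoTau f y h / (wenoTau f y h + wenoBetaBar f y h)) ^ p ∧
    wenoCk k * (wenoTau f y h / wenoBeta f y h k) ^ p *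
    (wenoTau f y h / (wenoTau f y h + wenoBetaBar f y h)) ^ p ≤ 3 / 2 * K * h ^ (6 * p) := by
    intro k
    have hk : 0 ≤ wenoCk k ∧ wenoCk k ≤ 3 / 2 := by
      fin_cases k <;> simp only [wenoCk] <;> norm_num
    obtain ⟨x1, x2⟩ := rat _ (hβ k)
    obtain ⟨x3, x4⟩ := rat (wenoTau f y h + wenoBetaBar f y h) (by linarith)
    refine ⟨mul_nonneg (mul_nonneg hk.1 x1) x3, ?_⟩
    calc _ ≤ 3 / 2 * ((C / c) ^ p * h ^ (3 * p)) * ((C / c) ^ p * h ^ (3 * p)) := by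
          gcongr
          exact hk.2
      _ = _ := by
        rw [hK, show 6 * p = 3 * p + 3 * p by ring, Real.rpow_add h0]; ring
  set E := 3 / 2 * K * h ^ (6 * p)
  have hα : ∀ k, ∃ e, 0 ≤ e ∧ e ≤ E ∧ alphaZC p f y h k = wenoD k * (1 + e) :=
    fun k => ⟨_, (hE k).1, (hE k).2, rfl⟩
  choose e he0 heE hea using hα
  have hsum : (∑ j : Fin 3, alphaZC p f y h j) = 1 + (e 0 + 6 * e 1 + 3 * e 2) / 10 := by
    rw [Fin.sum_univ_three, hea, hea, hea]; simp only [wenoD]; ring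
  have hS : 1 ≤ ∑ j : Fin 3, alphaZC p f y h j := by
    rw [hsum]; linarith [he0 0, he0 1, he0 2]
  refine ⟨fun k => by linarith [hβ k] |> fun (h : 0 < wenoBeta f y h k) => h.ne', by linarith |> fun (h : 0 < wenoTau f y h + wenoBetaBar f y h) => h.ne', by positivity, fun k => ?_⟩
  have hd : 0 ≤ wenoD k ∧ wenoD k ≤ 1 := by
    fin_cases k <;> simp only [wenoD] <;> norm_num
  set S := ∑ j : Fin 3, alphaZC p f y h j with hSdef
  have : omegaZC p f y h k - wenoD k = wenoD k * (e k - (e 0 + 6 * e 1 + 3 * e 2) / 10) / S := by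
    unfold omegaZC
    rw [← hSdef, hea, div_sub' (by linarith)]
    congr 1
    rw [hsum]; ring
  rw [this, abs_div, abs_of_pos (show 0 < S by linarith), abs_mul, abs_of_nonneg hd.1]
  have hdiff : |e k - (e 0 + 6 * e 1 + 3 * e 2) / 10| ≤ E := by
    rw [abs_le]
    constructor <;> linarith [he0 0, he0 1, he0 2, heE 0, heE 1, heE 2, he0 k, heE k]
  refine (div_le_self (by have := hd.1; positivity) hS).trans ?_
  have := mul_le_mul hd.2 hdiff (abs_nonneg _) zero_le_one
  linarith

/-- away from critical points (`f′(x) ≠ 0`), the WENO-ZC weights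
are well defined for all sufficiently small `Δx > 0` (nonvanishing denominators)
and satisfy `ω_k^{ZC,±} = d_k + O(Δx^{6p})` as `Δx → 0⁺` for every `k` and each
choice of sign (the left-boundary quantities are those based at `x − Δx`). -/
theorem weno_zc_weights_no_critical_point
    (f : ℝ → ℝ) (hf : ContDiff ℝ (⊤ : ℕ∞) f) (x : ℝ) (hx : deriv f x ≠ 0)
    (p : ℝ) (hp : 0 < p) :
    ∃ δ > (0 : ℝ),
      (∀ Δx : ℝ, 0 < Δx → Δx < δ →
        (∀ k : Fin 3, wenoBeta f x Δx k ≠ 0) ∧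
        (∀ k : Fin 3, wenoBeta f (x - Δx) Δx k ≠ 0) ∧
        wenoTau f x Δx + wenoBetaBar f x Δx ≠ 0 ∧
        wenoTau f (x - Δx) Δx + wenoBetaBar f (x - Δx) Δx ≠ 0 ∧
        (∑ j : Fin 3, alphaZC p f x Δx j) ≠ 0 ∧
        (∑ j : Fin 3, alphaZC p f (x - Δx) Δx j) ≠ 0) ∧
      ∀ k : Fin 3, ∃ C > (0 : ℝ), ∀ Δx : ℝ, 0 < Δx → Δx < δ →
        |omegaZC p f x Δx k - wenoD k| ≤ C * Δx ^ (6 * p) ∧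
        |omegaZC p f (x - Δx) Δx k - wenoD k| ≤ C * Δx ^ (6 * p) := by
  obtain ⟨δ, hδ, c, hc, C, hC, H⟩ := weno_est f hf x hx
  have main : ∀ Δx : ℝ, 0 < Δx → Δx < δ → _ ∧ _ := fun Δx h0 h1 =>
    And.intro
      (weno_final p hp f x Δx c C hc hC h0
        (H x Δx (by simpa using hδ) h0 h1).1 (H x Δx (by simpa using hδ) h0 h1).2)
      (weno_final p hp f (x - Δx) Δx c C hc hC h0
        (H (x - Δx) Δx (by simpa [abs_of_pos h0] using h1) h0 h1).1
        (H (x - Δx) Δx (by simpa [abs_of_pos h0] using h1) h0 h1).2)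
  refine ⟨δ, hδ, fun Δx h0 h1 => ?_, fun k => ⟨3 / 2 * ((C / c) ^ p * (C / c) ^ p),
    by positivity, fun Δx h0 h1 => ?_⟩⟩
  · obtain ⟨⟨a1, a2, a3, -⟩, b1, b2, b3, -⟩ := main Δx h0 h1
    exact ⟨a1, b1, a2, b2, a3, b3⟩
  · obtain ⟨⟨-, -, -, a⟩, -, -, -, b⟩ := main Δx h0 h1
    exact ⟨a k, b k⟩
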